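/- arXiv:2408.13719 — 2 statements merged into one kernel-verified Lean document; each statement's English description precedes it below -/
import Mathlib

section
/- Let L ≥ 1, t ≥ 1, let s_0, ..., s_t be a history of states over L boolean variables, let p < t be the index of the parent node and t the index of the child node, and let e = H(s_p, s_t) be the number of effect variables. Then the average normalized Hamming distances satisfy α(p) − ((t−1)/t)·(e/L) ≤ α(t) ≤ α(p) + ((t−1)/t)·(e/L). -/
/-- Hamming distance between two states over `L` boolean variables. -/
def hammingD {L : ℕ} (s s' : Fin L → Bool) : ℕ :=
  (Finset.univ.filter (fun i : Fin L => s i ≠ s' i)).card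

/-- Average normalized Hamming distance of the node at index `m` to the rest of the
history `s_0, ..., s_t`:  `α(m) = (1/t) · Σ_{j ≠ m} δ(s_m, s_j)`. -/
noncomputable def alphaAvg {L t : ℕ} (hist : Fin (t + 1) → Fin L → Bool)
    (m : Fin (t + 1)) : ℝ :=
  (1 / (t : ℝ)) * ∑ j ∈ Finset.univ.erase m, (hammingD (hist m) (hist j) : ℝ) / L

theorem hammingD_comm {L : ℕ} (s s' : Fin L → Bool) : hammingD s s' = hammingD s' s :=
  hammingDist_comm s s'

theorem hammingD_triangle {L : ℕ} (s s' s'' : Fin L → Bool) :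
    hammingD s s'' ≤ hammingD s s' + hammingD s' s'' :=
  hammingDist_triangle s s' s''

/-- The averages at two distinct nodes `a`, `b` differ by at most `((t-1)/t) · δ(s_a, s_b)`: the
two sums share the term `δ(s_a, s_b)`, and the other `t - 1` terms obey the triangle inequality. -/
theorem alphaAvg_le_add {L t : ℕ} (hist : Fin (t + 1) → Fin L → Bool) {a b : Fin (t + 1)}
    (hab : a ≠ b) :
    alphaAvg hist a ≤
      alphaAvg hist b + (((t : ℝ) - 1) / t) * ((hammingD (hist a) (hist b) : ℝ) / L) := by
  have ht : 1 ≤ t := by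
    have := Fin.val_ne_of_ne hab
    omega
  have hb : b ∈ Finset.univ.erase a := by simp [hab.symm]
  have ha : a ∈ Finset.univ.erase b := by simp [hab]
  have hcard : (((Finset.univ.erase a).erase b).card : ℝ) = (t : ℝ) - 1 := by
    rw [Finset.card_erase_of_mem hb, Finset.card_erase_of_mem (Finset.mem_univ a)]
    simp [Nat.cast_sub ht]
  have hsum : ∑ j ∈ (Finset.univ.erase a).erase b, (hammingD (hist a) (hist j) : ℝ) / L ≤
      ∑ j ∈ (Finset.univ.erase a).erase b, (hammingD (hist b) (hist j) : ℝ) / L +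
        ((t : ℝ) - 1) * ((hammingD (hist a) (hist b) : ℝ) / L) := by
    rw [← hcard, ← nsmul_eq_mul, ← Finset.sum_const, ← Finset.sum_add_distrib]
    refine Finset.sum_le_sum fun j _ => ?_
    rw [← add_div, add_comm]
    gcongr
    exact_mod_cast hammingD_triangle (hist a) (hist b) (hist j)
  unfold alphaAvg
  rw [← Finset.add_sum_erase _ _ hb, ← Finset.add_sum_erase _ _ ha,
    Finset.erase_right_comm (a := b), hammingD_comm (hist b) (hist a),
    ← one_div_mul_eq_div (t : ℝ) (t - 1), mul_assoc, ← mul_add]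
  refine mul_le_mul_of_nonneg_left ?_ (by positivity)
  linarith

/-- Parent-child bounds on the average normalized Hamming distance: if the child is the
last node `s_t`, the parent is `s_p` with `p < t`, and `e = H(s_p, s_t)`, then
`α(p) − ((t−1)/t)·(e/L) ≤ α(t) ≤ α(p) + ((t−1)/t)·(e/L)`. -/
theorem parent_child_alpha_bounds {L t : ℕ} (hL : 1 ≤ L) (ht : 1 ≤ t)
    (hist : Fin (t + 1) → Fin L → Bool) (p : Fin (t + 1)) (hp : (p : ℕ) < t) :
    alphaAvg hist p - (((t : ℝ) - 1) / t) * ((hammingD (hist p) (hist (Fin.last t)) : ℝ) / L) ≤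
        alphaAvg hist (Fin.last t) ∧
      alphaAvg hist (Fin.last t) ≤
        alphaAvg hist p + (((t : ℝ) - 1) / t) * ((hammingD (hist p) (hist (Fin.last t)) : ℝ) / L) := by
  have hne : p ≠ Fin.last t := (Fin.lt_def.mpr hp).ne
  have hp_le := alphaAvg_le_add hist hne
  have hlast_le := alphaAvg_le_add hist hne.symm
  rw [hammingD_comm] at hlast_le
  exact ⟨by linarith, hlast_le⟩
end

section
/- Let L ≥ 1, t ≥ 1, let s_0, ..., s_t be a history of states over L boolean variables, let p < t be the index of the parent node and t the index of the child node, let e = H(s_p, s_t), and let μ = min_{i ∈ Fin L} N_{t−1}^i(s_t)/t be the minimum empirical count distribution of the child state over the history s_0, ..., s_{t−1}. Then α(t) ≤ α(p) + ((t−1)/t)·(e − 2eμ)/L. -/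
theorem hammingD_eq_sum {L : ℕ} (s s' : Fin L → Bool) :
    (hammingD s s' : ℝ) = ∑ i, if s i ≠ s' i then (1 : ℝ) else 0 := by
  rw [hammingD, Finset.sum_boole]

theorem hammingD_self {L : ℕ} (s : Fin L → Bool) : hammingD s s = 0 := by
  simp [hammingD]

theorem alphaAvg_eq_sum_castSucc {L t : ℕ} (hist : Fin (t + 1) → Fin L → Bool)
    (m : Fin (t + 1)) :
    alphaAvg hist m = (1 / (t : ℝ)) * ((∑ j : Fin t, (hammingD (hist m) (hist j.castSucc) : ℝ)) +
      hammingD (hist m) (hist (Fin.last t))) / L := by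
  rw [alphaAvg, Finset.sum_erase _ (by simp [hammingD_self]), ← Finset.sum_div,
    Fin.sum_univ_castSucc, mul_div_assoc]

/-- Where `a` and `b` differ, a state agrees with `b` exactly if it differs from `a`; so the
distances of `a` and `b` to a list of states are related through agreement counts with `b`. -/
theorem sum_hammingD_sub_le {L t : ℕ} (f : Fin t → Fin L → Bool) (a b : Fin L → Bool) (c : ℝ)
    (hc : ∀ i, c ≤ ((Finset.univ.filter (fun j => f j i = b i)).card : ℝ)) :
    ∑ j, (hammingD b (f j) : ℝ) - ∑ j, (hammingD a (f j) : ℝ) ≤ hammingD a b * (t - 2 * c) := by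
  simp only [hammingD_eq_sum]
  rw [Finset.sum_comm, Finset.sum_comm (s := Finset.univ (α := Fin t)), ← Finset.sum_sub_distrib,
    Finset.sum_mul]
  refine Finset.sum_le_sum fun i _ => ?_
  by_cases h : a i = b i
  · simp [h]
  · have key : ∀ j, ((if b i ≠ f j i then (1 : ℝ) else 0) - if a i ≠ f j i then (1 : ℝ) else 0) =
        1 - 2 * if f j i = b i then (1 : ℝ) else 0 := by
      intro j
      revert h
      cases a i <;> cases b i <;> cases f j i <;> norm_num
    rw [← Finset.sum_sub_distrib, Finset.sum_congr rfl fun j _ => key j,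
      Finset.sum_sub_distrib, ← Finset.mul_sum, Finset.sum_boole]
    have := hc i
    simp only [Finset.sum_const, Finset.card_univ, Fintype.card_fin, nsmul_eq_mul, mul_one, ne_eq,
      h, not_false_eq_true, if_true, one_mul]
    linarith

/-- Parent-child upper bound with the minimum empirical count distribution: if the child
is the last node `s_t`, the parent is `s_p` with `p < t`, `e = H(s_p, s_t)`, and
`μ = min_i N_{t−1}^i(s_t)/t` (counts taken over the history `s_0, ..., s_{t−1}`), then
`α(t) ≤ α(p) + ((t−1)/t)·(e − 2eμ)/L`. -/
theorem parent_child_alpha_upper_bound_mu {L t : ℕ} (hL : 1 ≤ L) (ht : 1 ≤ t)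
    (hist : Fin (t + 1) → Fin L → Bool) (p : Fin (t + 1)) (hp : (p : ℕ) < t) :
    alphaAvg hist (Fin.last t) ≤
      alphaAvg hist p + (((t : ℝ) - 1) / t) *
        (((hammingD (hist p) (hist (Fin.last t))) : ℝ) -
            2 * (hammingD (hist p) (hist (Fin.last t)) : ℝ) *
              ⨅ i : Fin L, ((Finset.univ.filter (fun j : Fin t =>
                hist (Fin.castSucc j) i = hist (Fin.last t) i)).card : ℝ) / t) / L := by
  have hL' : (0 : ℝ) < L := by exact_mod_cast hL
  have ht' : (0 : ℝ) < t := by exact_mod_cast ht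
  set μ : ℝ := ⨅ i : Fin L, ((Finset.univ.filter (fun j : Fin t =>
    hist (Fin.castSucc j) i = hist (Fin.last t) i)).card : ℝ) / t with hμ
  have hμ_nonneg : 0 ≤ μ := Real.iInf_nonneg fun i => by positivity
  have hμ_le : ∀ i, t * μ ≤ ((Finset.univ.filter (fun j : Fin t =>
      hist (Fin.castSucc j) i = hist (Fin.last t) i)).card : ℝ) := fun i => by
    have h := ciInf_le (Set.finite_range (fun i : Fin L => ((Finset.univ.filter (fun j : Fin t =>
      hist (Fin.castSucc j) i = hist (Fin.last t) i)).card : ℝ) / t)).bddBelow i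
    rwa [← hμ, le_div_iff₀ ht', mul_comm] at h
  have key := sum_hammingD_sub_le (fun j => hist (Fin.castSucc j)) (hist p) (hist (Fin.last t))
    (t * μ) hμ_le
  rw [alphaAvg_eq_sum_castSucc, alphaAvg_eq_sum_castSucc, hammingD_self, ← add_div,
    div_le_div_iff_of_pos_right hL', one_div, div_eq_inv_mul, mul_assoc, ← mul_add]
  refine mul_le_mul_of_nonneg_left ?_ (by positivity)
  have he : 0 ≤ (hammingD (hist p) (hist (Fin.last t)) : ℝ) * μ := by positivity
  push_cast
  linarith
end
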